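/- arXiv:math/0004168 — 4 statements merged into one kernel-verified Lean document; each statement's English description precedes it below -/
import Mathlib

section
/- Let X be a real or complex Banach space containing asymptotically isometric copies of ℓ₁. Then ℓ₁ is linearly isometric to a quotient space of a subspace of X; that is, there exist a closed subspace X₀ of X, a closed subspace X₁ of X₀, and a surjective linear isometry from the quotient Banach space X₀/X₁ onto ℓ₁. -/
open Filter Finset

/-- `X` contains asymptotically isometric copies of `ℓ₁`. -/
def ContainsAICopiesOfL1 (𝕜 X : Type*) [RCLike 𝕜] [NormedAddCommGroup X]
    [NormedSpace 𝕜 X] : Prop :=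
  ∃ (ε : ℕ → ℝ) (x : ℕ → X), (∀ n, 0 < ε n ∧ ε n < 1) ∧
    Tendsto ε atTop (nhds 0) ∧
    ∀ (m : ℕ) (a : ℕ → 𝕜),
      (∑ n ∈ Finset.range m, (1 - ε n) * ‖a n‖) ≤ ‖∑ n ∈ Finset.range m, a n • x n‖ ∧
      ‖∑ n ∈ Finset.range m, a n • x n‖ ≤ ∑ n ∈ Finset.range m, ‖a n‖

theorem l1_lift {𝕜 : Type*} [RCLike 𝕜] {E : Type*} [NormedAddCommGroup E] [NormedSpace 𝕜 E]
    [CompleteSpace E] (y : ℕ → E) (C : ℝ) (hy : ∀ n, ‖y n‖ ≤ C) :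
    ∃ L : lp (fun _ : ℕ => 𝕜) 1 →L[𝕜] E, (∀ a, HasSum (fun n => a n • y n) (L a)) ∧
      ∀ a, ‖L a‖ ≤ C * ‖a‖ := by
  have hs : ∀ a : lp (fun _ : ℕ => 𝕜) 1, HasSum (fun n => ‖a n‖) ‖a‖ := by
    intro a
    have := lp.hasSum_norm (p := 1) (by simp) a
    simpa using this
  have hle : ∀ (a : lp (fun _ : ℕ => 𝕜) 1) n, ‖a n • y n‖ ≤ C * ‖a n‖ := by
    intro a n
    rw [norm_smul, mul_comm]
    exact mul_le_mul_of_nonneg_right (hy n) (norm_nonneg _)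
  have hsum : ∀ a : lp (fun _ : ℕ => 𝕜) 1, Summable (fun n => a n • y n) := fun a =>
    Summable.of_norm_bounded ((hs a).summable.mul_left C) (hle a)
  let L : lp (fun _ : ℕ => 𝕜) 1 →ₗ[𝕜] E :=
    { toFun := fun a => ∑' n, a n • y n
      map_add' := by
        intro a b
        rw [← (hsum a).tsum_add (hsum b)]
        simp [add_smul]
      map_smul' := by
        intro c a
        simp only [RingHom.id_apply]
        rw [← (hsum a).tsum_const_smul c]
        simp [mul_smul] }
  have hb : ∀ a, ‖L a‖ ≤ C * ‖a‖ := fun a => tsum_of_norm_bounded ((hs a).mul_left C) (hle a)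
  exact ⟨L.mkContinuous C hb, fun a => (hsum a).hasSum, hb⟩

/-- If `X` contains asymptotically isometric copies of `ℓ₁`, then `ℓ₁` is linearly
isometric to a quotient space of a subspace of `X`. -/
theorem l1_quotient_of_subspace_of_ai (𝕜 : Type*) [RCLike 𝕜]
    (X : Type*) [NormedAddCommGroup X] [NormedSpace 𝕜 X] [CompleteSpace X]
    (h : ContainsAICopiesOfL1 𝕜 X) :
    ∃ (X₀ : Subspace 𝕜 X), IsClosed (X₀ : Set X) ∧
      ∃ (X₁ : Subspace 𝕜 X₀), IsClosed (X₁ : Set X₀) ∧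
        Nonempty ((X₀ ⧸ X₁) ≃ₗᵢ[𝕜] lp (fun _ : ℕ => 𝕜) 1) := by
  obtain ⟨ε, x, hε, hlim, hx⟩ := h
  let e : ℕ → lp (fun _ : ℕ => 𝕜) 1 := fun n => lp.single 1 n (1 : 𝕜)
  have he : ∀ n, ‖e n‖ = 1 := fun n => by
    simp [e, lp.norm_single]
  have hea : ∀ a : lp (fun _ : ℕ => 𝕜) 1, HasSum (fun n => a n • e n) a := by
    intro a
    have := lp.hasSum_single (p := 1) (by simp) a
    convert this using 2 with n
    simp only [e]
    rw [← lp.single_smul]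
    simp
  have hLe' : ∀ (y : ℕ → lp (fun _ : ℕ => 𝕜) 1)
      (L : lp (fun _ : ℕ => 𝕜) 1 →L[𝕜] lp (fun _ : ℕ => 𝕜) 1),
      (∀ a, HasSum (fun n => a n • y n) (L a)) →
      ∀ n, L (e n) = y n := by
    intro y L hL n
    refine (hL (e n)).unique ?_
    convert hasSum_single n ?_ using 1
    · simp [e]
    · intro m hm
      simp [e, hm]
  have hx1 : ∀ n, ‖x n‖ ≤ 1 := by
    intro n
    have := (hx (n+1) (fun m => if m = n then 1 else 0)).2
    simpa [apply_ite norm] using this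
  obtain ⟨T, hT, hTb⟩ := l1_lift (𝕜 := 𝕜) x 1 hx1
  -- comparison
  have hcomp : ∀ (y : ℕ → lp (fun _ : ℕ => 𝕜) 1), (∀ n, ‖y n‖ ≤ 1 - ε n) → 
      ∀ a b : lp (fun _ : ℕ => 𝕜) 1, HasSum (fun n => a n • y n) b → ‖b‖ ≤ ‖T a‖ := by
    intro y hy a b hb
    refine le_of_tendsto_of_tendsto' hb.tendsto_sum_nat.norm (hT a).tendsto_sum_nat.norm ?_
    intro m
    refine le_trans ?_ (hx m a).1
    refine norm_sum_le_of_le _ fun n _ => ?_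
    rw [norm_smul, mul_comm]
    exact mul_le_mul_of_nonneg_right (hy n) (norm_nonneg _)
  obtain ⟨c, hc0, hc⟩ : ∃ c : ℝ, 0 < c ∧ ∀ n, c ≤ 1 - ε n := by
    have h1 : Tendsto (fun n => (1 - ε n)⁻¹) atTop (nhds ((1 - 0)⁻¹)) :=
      (tendsto_const_nhds.sub hlim).inv₀ (by norm_num)
    obtain ⟨M, hM⟩ := h1.bddAbove_range
    have hM' : ∀ n, (1 - ε n)⁻¹ ≤ M := fun n => hM ⟨n, rfl⟩
    have hp : ∀ n, 0 < 1 - ε n := fun n => by linarith [(hε n).2]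
    have hM0 : 0 < M := lt_of_lt_of_le (inv_pos.2 (hp 0)) (hM' 0)
    exact ⟨M⁻¹, inv_pos.2 hM0, fun n => inv_le_of_inv_le₀ (hp n) (hM' n)⟩
  have hlow : ∀ a, c * ‖a‖ ≤ ‖T a‖ := by
    intro a
    have := hcomp (fun n => (c : 𝕜) • e n) (fun n => by
      rw [norm_smul, he]; simpa [abs_of_pos hc0] using hc n) a ((c : 𝕜) • a) (by
        convert (hea a).const_smul (c : 𝕜) using 2 with n
        rw [smul_comm])
    rw [norm_smul] at this
    simpa [abs_of_pos hc0] using this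
  have hanti : AntilipschitzWith (Real.toNNReal c⁻¹) T := by
    refine AddMonoidHomClass.antilipschitz_of_bound T fun a => ?_
    rw [Real.coe_toNNReal _ (inv_pos.2 hc0).le, inv_mul_eq_div, le_div_iff₀ hc0, mul_comm]
    exact hlow a
  -- the quotient map on `ℓ₁`
  obtain ⟨Q, hQ, -⟩ := l1_lift (𝕜 := 𝕜)
    (fun n => ((1 - ε n : ℝ) : 𝕜) • e (Nat.unpair n).1) 1 (fun n => by
      rw [norm_smul, he, RCLike.norm_ofReal, abs_of_pos (by linarith [(hε n).2])]
      linarith [(hε n).1])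
  have hQe := hLe' _ Q hQ
  have hQT : ∀ a, ‖Q a‖ ≤ ‖T a‖ := fun a => hcomp _ (fun n => by
      rw [norm_smul, he, RCLike.norm_ofReal, abs_of_pos (by linarith [(hε n).2])]
      linarith [(hε n).1]) a _ (hQ a)
  have hlift : ∀ δ : ℝ, 0 < δ → δ < 1 → ∀ b, ∃ a, Q a = b ∧ ‖T a‖ ≤ (1 - δ)⁻¹ * ‖b‖ := by
    intro δ h0 h1 b
    have : ∀ j : ℕ, ∃ n : ℕ, (Nat.unpair n).1 = j ∧ ε n < δ := by
      intro j
      obtain ⟨N, hN⟩ := eventually_atTop.1 (hlim.eventually_lt_const h0)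
      exact ⟨Nat.pair j N, by simp, hN _ (Nat.right_le_pair _ _)⟩
    choose k hk1 hk2 using this
    obtain ⟨R, hR, hRb⟩ := l1_lift (𝕜 := 𝕜)
      (fun j => (((1 - ε (k j))⁻¹ : ℝ) : 𝕜) • e (k j)) (1 - δ)⁻¹ (fun j => by
        have := (hε (k j)).2
        have := hk2 j
        rw [norm_smul, he, RCLike.norm_ofReal, abs_of_pos (inv_pos.2 (by linarith)), mul_one]
        exact inv_anti₀ (by linarith) (by linarith))
    refine ⟨R b, ?_, ?_⟩
    · have h2 := (hR b).mapL Q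
      refine h2.unique ?_
      convert hea b using 2 with j
      have hne : ((1 - ε (k j) : ℝ) : 𝕜) ≠ 0 := by
        have := (hε (k j)).2
        exact_mod_cast (by linarith : 0 < 1 - ε (k j)).ne'
      rw [map_smul, map_smul, hQe, hk1, RCLike.ofReal_inv, smul_smul _ _ (e j),
        inv_mul_cancel₀ hne, one_smul]
    · have := hTb (R b)
      rw [one_mul] at this
      exact this.trans (hRb b)
  let X₀ : Subspace 𝕜 X := LinearMap.range T.toLinearMap
  let φ : lp (fun _ : ℕ => 𝕜) 1 ≃ₗ[𝕜] X₀ := LinearEquiv.ofInjective T.toLinearMap hanti.injective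
  have hφ : ∀ a, ‖φ a‖ = ‖T a‖ := fun a => rfl
  let S : X₀ →L[𝕜] lp (fun _ : ℕ => 𝕜) 1 :=
    (Q.toLinearMap ∘ₗ φ.symm.toLinearMap).mkContinuous 1 (fun z => by
      obtain ⟨a, rfl⟩ := φ.surjective z
      simpa [hφ] using hQT a)
  have hSφ : ∀ a, S (φ a) = Q a := fun a => by simp [S]
  have hS1 : ∀ z, ‖S z‖ ≤ ‖z‖ := fun z => by
    obtain ⟨a, rfl⟩ := φ.surjective z
    rw [hSφ, hφ]; exact hQT a
  have hSs : Function.Surjective S := fun b => by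
    obtain ⟨a, ha, -⟩ := hlift (1/2) (by norm_num) (by norm_num) b
    exact ⟨φ a, by rw [hSφ, ha]⟩
  refine ⟨X₀, ?_, LinearMap.ker S.toLinearMap, S.isClosed_ker, ⟨?_⟩⟩
  · have := hanti.isClosed_range T.uniformContinuous
    convert this using 1
    ext z
    simp [X₀]
  · refine ⟨S.toLinearMap.quotKerEquivOfSurjective hSs, ?_⟩
    intro q
    obtain ⟨z, rfl⟩ := Submodule.Quotient.mk_surjective _ q
    have h1 : S.toLinearMap.quotKerEquivOfSurjective hSs (Submodule.Quotient.mk z) = S z := rfl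
    rw [h1]
    apply le_antisymm
    · refine le_of_forall_pos_le_add fun η hη => ?_
      obtain ⟨w, hw, hw2⟩ := Submodule.Quotient.norm_mk_lt
        (S := LinearMap.ker S.toLinearMap) (Submodule.Quotient.mk z) hη
      rw [Submodule.Quotient.eq] at hw
      have : S w = S z := by
        have := LinearMap.mem_ker.1 hw
        rw [map_sub] at this
        exact sub_eq_zero.1 this
      rw [← this]
      exact (hS1 w).trans hw2.le
    · have key : ∀ δ : ℝ, 0 < δ → δ < 1 →
          (1 - δ) * ‖(Submodule.Quotient.mk z : X₀ ⧸ LinearMap.ker S.toLinearMap)‖ ≤ ‖S z‖ := by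
        intro δ h0 h1
        obtain ⟨a, ha, hab⟩ := hlift δ h0 h1 (S z)
        have hz : (Submodule.Quotient.mk z : X₀ ⧸ LinearMap.ker S.toLinearMap)
            = Submodule.Quotient.mk (φ a) := by
          rw [Submodule.Quotient.eq, LinearMap.mem_ker, map_sub]
          exact sub_eq_zero.2 (((hSφ a).trans ha).symm)
        rw [hz]
        have h3 := (Submodule.Quotient.norm_mk_le (LinearMap.ker S.toLinearMap) (φ a)).trans hab
        rwa [inv_mul_eq_div, le_div_iff₀ (by linarith), mul_comm] at h3
      have ht : Tendsto (fun δ : ℝ => (1 - δ) *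
          ‖(Submodule.Quotient.mk z : X₀ ⧸ LinearMap.ker S.toLinearMap)‖) (nhdsWithin 0 (Set.Ioi 0))
          (nhds ((1 - 0) *
          ‖(Submodule.Quotient.mk z : X₀ ⧸ LinearMap.ker S.toLinearMap)‖)) := by
        refine Tendsto.mono_left (Continuous.tendsto ?_ 0) nhdsWithin_le_nhds
        fun_prop
      rw [sub_zero, one_mul] at ht
      refine le_of_tendsto ht ?_
      filter_upwards [Ioo_mem_nhdsGT (zero_lt_one' ℝ)] with δ hδ
      exact key δ hδ.1 hδ.2
end

section
/- Let X be a separable real or complex Banach space containing asymptotically isometric copies of ℓ₁. Then C(Δ), the Banach space of continuous scalar-valued functions on the Cantor set Δ with the supremum norm, is isometric to a quotient space of X; that is, there exist a closed subspace Y of X and a surjective linear isometry from X/Y onto C(Δ). -/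
open Filter Finset

section CantorPart
open Set CantorScheme
open scoped ENNReal

theorem aux_small_nhd {α : Type*} [MetricSpace α] {W : Set α} (hW : IsOpen W) {x : α} (hx : x ∈ W)
    {ε : ℝ≥0∞} (hε : 0 < ε) :
    ∃ U : Set α, IsOpen U ∧ x ∈ U ∧ closure U ⊆ W ∧ Metric.ediam U ≤ ε := by
  obtain ⟨δ, hδ, hδW⟩ := Metric.nhds_basis_closedEBall.mem_iff.1 (hW.mem_nhds hx)
  have hε2 : 0 < ε / 2 := ENNReal.half_pos hε.ne'
  refine ⟨Metric.eball x (min δ (ε / 2)), Metric.isOpen_eball,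
    Metric.mem_eball_self (lt_min hδ hε2), ?_, ?_⟩
  · refine Subset.trans (closure_minimal ?_ Metric.isClosed_closedEBall) hδW
    intro y hy
    exact (lt_of_lt_of_le (Metric.mem_eball.1 hy) (min_le_left _ _)).le
  · refine Metric.ediam_eball_le.trans ?_
    calc 2 * min δ (ε / 2) ≤ 2 * (ε / 2) := by gcongr; exact min_le_right _ _
      _ = ε := by rw [mul_comm, ENNReal.div_mul_cancel] <;> norm_num

theorem aux_splitting {α Y : Type*} [MetricSpace α] [TopologicalSpace Y] [T2Space Y]
    {q : α → Y} (hqc : Continuous q)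
    (hq : ∀ U : Set α, IsOpen U → U.Nonempty → ∃ a ∈ U, ∃ b ∈ U, q a ≠ q b)
    {U : Set α} (hU : IsOpen U) (hne : U.Nonempty) {ε : ℝ≥0∞} (hε : 0 < ε) :
    ∃ U₀ U₁ : Set α, (IsOpen U₀ ∧ U₀.Nonempty ∧ closure U₀ ⊆ U ∧ Metric.ediam U₀ ≤ ε) ∧
      (IsOpen U₁ ∧ U₁.Nonempty ∧ closure U₁ ⊆ U ∧ Metric.ediam U₁ ≤ ε) ∧
      Disjoint (q '' U₀) (q '' U₁) := by
  obtain ⟨a, ha, b, hb, hab⟩ := hq U hU hne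
  obtain ⟨V₀, V₁, h0, h1, ha', hb', hd⟩ := t2_separation hab
  obtain ⟨U₀, o0, m0, c0, d0⟩ := aux_small_nhd (hU.inter (h0.preimage hqc)) ⟨ha, ha'⟩ hε
  obtain ⟨U₁, o1, m1, c1, d1⟩ := aux_small_nhd (hU.inter (h1.preimage hqc)) ⟨hb, hb'⟩ hε
  refine ⟨U₀, U₁, ⟨o0, ⟨a, m0⟩, fun x hx => (c0 hx).1, d0⟩,
    ⟨o1, ⟨b, m1⟩, fun x hx => (c1 hx).1, d1⟩, ?_⟩
  refine hd.mono ?_ ?_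
  · rintro _ ⟨x, hx, rfl⟩
    exact (c0 (subset_closure hx)).2
  · rintro _ ⟨x, hx, rfl⟩
    exact (c1 (subset_closure hx)).2

theorem aux_cantor {α Y : Type*} [MetricSpace α] [CompleteSpace α] [Nonempty α]
    [TopologicalSpace Y] [T2Space Y]
    {q : α → Y} (hqc : Continuous q)
    (hq : ∀ U : Set α, IsOpen U → U.Nonempty → ∃ a ∈ U, ∃ b ∈ U, q a ≠ q b) :
    ∃ g : (ℕ → Bool) → α, Continuous g ∧ Function.Injective (fun s => q (g s)) := by
  obtain ⟨u, -, upos', hu⟩ := exists_seq_strictAnti_tendsto' (zero_lt_one' ℝ≥0∞)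
  have upos := fun n => (upos' n).1
  let P := Subtype fun E : Set α => IsOpen E ∧ E.Nonempty
  choose C0 C1 h0 h1 hdisj using
    fun {C : Set α} (hC : IsOpen C) (hnonempty : C.Nonempty) {ε : ℝ≥0∞} (hε : 0 < ε) =>
    aux_splitting hqc hq hC hnonempty hε
  let DP : List Bool → P := fun l => by
    induction l with
    | nil => exact ⟨univ, ⟨isOpen_univ, univ_nonempty⟩⟩
    | cons a l ih =>
      cases a
      · use C0 ih.property.1 ih.property.2 (upos (l.length + 1))
        exact ⟨(h0 _ _ _).1, (h0 _ _ _).2.1⟩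
      use C1 ih.property.1 ih.property.2 (upos (l.length + 1))
      exact ⟨(h1 _ _ _).1, (h1 _ _ _).2.1⟩
  let D : List Bool → Set α := fun l => (DP l).val
  have hanti : ClosureAntitone D := by
    intro l a
    cases a
    · exact (h0 _ _ _).2.2.1
    exact (h1 _ _ _).2.2.1
  have hdiam : VanishingDiam D := by
    intro x
    apply tendsto_of_tendsto_of_tendsto_of_le_of_le' tendsto_const_nhds hu
    · simp
    rw [eventually_atTop]
    refine ⟨1, fun m (hm : 1 ≤ m) => ?_⟩
    rw [Nat.one_le_iff_ne_zero] at hm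
    rcases Nat.exists_eq_succ_of_ne_zero hm with ⟨n, rfl⟩
    dsimp
    cases x n
    · convert! (h0 _ _ _).2.2.2
      rw [PiNat.res_length]
    convert! (h1 _ _ _).2.2.2
    rw [PiNat.res_length]
  have hdisj' : CantorScheme.Disjoint (fun l => q '' D l) := by
    rintro l (a | a) (b | b) hab <;> try contradiction
    · exact hdisj _ _ _
    exact (hdisj _ _ _).symm
  have hdom : ∀ {x : ℕ → Bool}, x ∈ (inducedMap D).1 := fun {x} => by
    rw [hanti.map_of_vanishingDiam hdiam fun l => (DP l).property.2]
    exact Set.mem_univ _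
  refine ⟨fun x => (inducedMap D).2 ⟨x, hdom⟩, ?_, ?_⟩
  · apply hdiam.map_continuous.comp
    fun_prop
  intro x y hxy
  have hx : ∀ n, (inducedMap D).2 ⟨x, hdom⟩ ∈ D (PiNat.res x n) := fun n => map_mem ⟨x, hdom⟩ n
  have hy : ∀ n, (inducedMap D).2 ⟨y, hdom⟩ ∈ D (PiNat.res y n) := fun n => map_mem ⟨y, hdom⟩ n
  apply PiNat.res_injective
  ext n : 1
  induction n with
  | zero => simp
  | succ n ih =>
    rw [PiNat.res_succ, PiNat.res_succ, ih]
    congr 1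
    by_contra hne
    have h1 := hx (n + 1)
    have h2 := hy (n + 1)
    rw [PiNat.res_succ] at h1 h2
    rw [ih] at h1
    refine Set.disjoint_left.1 (hdisj' (PiNat.res y n) hne) ⟨_, h1, rfl⟩ ⟨_, h2, hxy.symm⟩

theorem aux_two_points {V : Set (ℕ → Bool)} (hV : IsOpen V) {y : ℕ → Bool} (hy : y ∈ V) :
    ∃ z ∈ V, z ≠ y := by
  have hc : Tendsto (fun n => Function.update y n (!(y n))) atTop (nhds y) := by
    rw [tendsto_pi_nhds]
    intro i
    refine tendsto_const_nhds.congr' ?_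
    filter_upwards [eventually_gt_atTop i] with n hn
    rw [Function.update_of_ne hn.ne]
  obtain ⟨n, hn⟩ := (hc.eventually (hV.mem_nhds hy)).exists
  refine ⟨_, hn, fun h => ?_⟩
  have := congrFun h n
  simp at this

/-- a compact metrizable space mapping onto the Cantor set contains a Cantor set on which the
map is injective -/
theorem aux_section {K : Type*} [TopologicalSpace K] [CompactSpace K]
    [TopologicalSpace.MetrizableSpace K] {q : K → (ℕ → Bool)} (hqc : Continuous q)
    (hs : Function.Surjective q) :
    ∃ g : (ℕ → Bool) → K, Continuous g ∧ Function.Injective (fun s => q (g s)) := by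
  let _ := TopologicalSpace.metrizableSpaceMetric K
  obtain ⟨E, hE, hEs, hmin⟩ : ∃ E : Set K, CompactSpace E ∧ q '' E = univ ∧
      ∀ E₀ : Set E, E₀ ≠ univ → IsClosed E₀ → E.domRestrict q '' E₀ ≠ univ := by
    obtain ⟨E, hE, hEs, hmin⟩ := exists_compact_surjective_zorn_subset
      (X := fun k => (ULift.up (q k) : ULift (ℕ → Bool))) (continuous_uliftUp.comp hqc)
      (ULift.up_surjective.comp hs)
    refine ⟨E, hE, ?_, ?_⟩
    · rw [eq_univ_iff_forall] at hEs ⊢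
      intro y
      obtain ⟨x, hx, hxy⟩ := hEs (ULift.up y)
      exact ⟨x, hx, congrArg ULift.down hxy⟩
    · intro E₀ h1 h2 h3
      refine hmin E₀ h1 h2 ?_
      rw [eq_univ_iff_forall] at h3 ⊢
      intro y
      obtain ⟨x, hx, hxy⟩ := h3 y.down
      exact ⟨x, hx, congrArg ULift.up hxy⟩
  have hne : Nonempty E := by
    have : (fun _ => true) ∈ q '' E := by rw [hEs]; trivial
    obtain ⟨x, hx, -⟩ := this
    exact ⟨⟨x, hx⟩⟩
  have hrc : Continuous (E.domRestrict q) := hqc.continuousOn.domRestrict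
  obtain ⟨g, hg, hi⟩ := aux_cantor (q := E.domRestrict q) hrc (by
    intro U hU hUne
    have h1 := hmin Uᶜ (by rwa [Ne, compl_univ_iff, ← Ne, ← Set.nonempty_iff_ne_empty]) hU.isClosed_compl
    have hcl : IsClosed (E.domRestrict q '' Uᶜ) :=
      (hU.isClosed_compl.isCompact.image hrc).isClosed
    obtain ⟨y, hy⟩ := (ne_univ_iff_exists_notMem _).1 h1
    obtain ⟨z, hz, hzy⟩ := aux_two_points hcl.isOpen_compl hy
    have key : ∀ w, w ∉ E.domRestrict q '' Uᶜ → ∃ a ∈ U, E.domRestrict q a = w := by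
      intro w hw
      have : w ∈ q '' E := by rw [hEs]; trivial
      obtain ⟨x, hx, hxw⟩ := this
      refine ⟨⟨x, hx⟩, ?_, hxw⟩
      by_contra hc
      exact hw ⟨⟨x, hx⟩, hc, hxw⟩
    obtain ⟨a, ha, rfl⟩ := key y hy
    obtain ⟨b, hb, rfl⟩ := key z hz
    exact ⟨b, hb, a, ha, hzy⟩)
  exact ⟨fun s => (g s).1, continuous_subtype_val.comp hg, hi⟩

end CantorPart

theorem aux_quotient {𝕜 X Z : Type*} [RCLike 𝕜] [NormedAddCommGroup X] [NormedSpace 𝕜 X]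
    [CompleteSpace X] [NormedAddCommGroup Z] [NormedSpace 𝕜 Z]
    (T : X →L[𝕜] Z) (hT : ∀ x, ‖T x‖ ≤ ‖x‖)
    (happ : ∀ u : Z, ‖u‖ ≤ 1 → ∀ δ > 0, ∃ x : X, ‖x‖ ≤ 1 ∧ ‖u - T x‖ ≤ δ) :
    ∃ Y : Subspace 𝕜 X, IsClosed (Y : Set X) ∧ Nonempty ((X ⧸ Y) ≃ₗᵢ[𝕜] Z) := by
  have happ' : ∀ δ > 0, ∀ u : Z, ∃ x : X, ‖x‖ ≤ ‖u‖ ∧ ‖u - T x‖ ≤ δ * ‖u‖ := by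
    intro δ hδ u
    rcases eq_or_ne u 0 with rfl | hu
    · exact ⟨0, by simp⟩
    have hn : 0 < ‖u‖ := norm_pos_iff.2 hu
    have hn' : (‖u‖ : 𝕜) ≠ 0 := by exact_mod_cast hn.ne'
    obtain ⟨x, hx, hxu⟩ := happ ((‖u‖ : 𝕜)⁻¹ • u) (by
      rw [norm_smul, norm_inv, RCLike.norm_ofReal, abs_norm, inv_mul_cancel₀ hn.ne']) δ hδ
    refine ⟨(‖u‖ : 𝕜) • x, ?_, ?_⟩
    · rw [norm_smul, RCLike.norm_ofReal, abs_norm]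
      nlinarith
    · have : u - T ((‖u‖ : 𝕜) • x) = (‖u‖ : 𝕜) • ((‖u‖ : 𝕜)⁻¹ • u - T x) := by
        rw [smul_sub, smul_inv_smul₀ hn', map_smul]
      rw [this, norm_smul, RCLike.norm_ofReal, abs_norm, mul_comm]
      gcongr
  have hsurj : ∀ δ : ℝ, 0 < δ → δ < 1 → ∀ u : Z, ∃ x, T x = u ∧ ‖x‖ ≤ (1 - δ)⁻¹ * ‖u‖ := by
    intro δ hδ hδ1 u
    choose F hF1 hF2 using happ' δ hδ
    let v : ℕ → Z := fun n => (fun w => w - T (F w))^[n] u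
    have hv0 : v 0 = u := rfl
    have hvs : ∀ n, v (n + 1) = v n - T (F (v n)) := fun n => by
      simp only [v, Function.iterate_succ_apply']
    have hvn : ∀ n, ‖v n‖ ≤ δ ^ n * ‖u‖ := by
      intro n
      induction n with
      | zero => simp [hv0]
      | succ n ih =>
        rw [hvs]
        refine (hF2 _).trans ?_
        rw [pow_succ']
        nlinarith
    have hgeo : HasSum (fun n => δ ^ n * ‖u‖) ((1 - δ)⁻¹ * ‖u‖) :=
      (hasSum_geometric_of_lt_one hδ.le hδ1).mul_right _
    have hb : ∀ n, ‖F (v n)‖ ≤ δ ^ n * ‖u‖ := fun n => (hF1 _).trans (hvn n)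
    have hsum : Summable fun n => F (v n) := Summable.of_norm_bounded hgeo.summable hb
    refine ⟨∑' n, F (v n), ?_, tsum_of_norm_bounded hgeo hb⟩
    have h1 : Tendsto (fun n => T (∑ i ∈ range n, F (v i))) atTop (nhds (T (∑' n, F (v n)))) :=
      (T.continuous.tendsto _).comp hsum.hasSum.tendsto_sum_nat
    have h2 : ∀ n, T (∑ i ∈ range n, F (v i)) = u - v n := by
      intro n
      induction n with
      | zero => simp [hv0]
      | succ n ih => rw [sum_range_succ, map_add, ih, hvs]; abel
    have h3 : Tendsto v atTop (nhds 0) := by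
      refine squeeze_zero_norm hvn ?_
      simpa using (tendsto_pow_atTop_nhds_zero_of_lt_one hδ.le hδ1).mul_const ‖u‖
    have h4 : Tendsto (fun n => u - v n) atTop (nhds u) := by
      simpa using tendsto_const_nhds.sub h3
    simp only [h2] at h1
    exact tendsto_nhds_unique h1 h4
  let Y : Submodule 𝕜 X := LinearMap.ker (T : X →ₗ[𝕜] Z)
  have hnorm : ∀ z : X ⧸ Y, ‖Y.liftQ (T : X →ₗ[𝕜] Z) le_rfl z‖ = ‖z‖ := by
    intro z
    apply le_antisymm
    · refine le_of_forall_pos_le_add fun ε hε => ?_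
      obtain ⟨m, rfl, hm⟩ := Submodule.Quotient.norm_mk_lt z hε
      rw [Submodule.liftQ_apply]
      exact (hT m).trans hm.le
    · obtain ⟨m, rfl⟩ := Submodule.Quotient.mk_surjective Y z
      rw [Submodule.liftQ_apply]
      have h1 : ∀ δ : ℝ, 0 < δ → δ < 1 →
          ‖(Submodule.Quotient.mk m : X ⧸ Y)‖ ≤ (1 - δ)⁻¹ * ‖T m‖ := by
        intro δ h0 h1
        obtain ⟨x, hx, hxn⟩ := hsurj δ h0 h1 (T m)
        have : (Submodule.Quotient.mk m : X ⧸ Y) = Submodule.Quotient.mk x := by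
          rw [Submodule.Quotient.eq]
          simp [Y, hx]
        rw [this]
        exact (Submodule.Quotient.norm_mk_le Y x).trans hxn
      have h2 : Tendsto (fun δ : ℝ => (1 - δ)⁻¹ * ‖T m‖) (nhdsWithin 0 (Set.Ioi 0))
          (nhds ‖T m‖) := by
        have : ContinuousAt (fun δ : ℝ => (1 - δ)⁻¹ * ‖T m‖) 0 := by
          refine ContinuousAt.mul (ContinuousAt.inv₀ (by fun_prop) (by norm_num)) (by fun_prop)
        have h := this.tendsto
        simp only [sub_zero, inv_one, one_mul] at h
        exact h.mono_left nhdsWithin_le_nhds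
      refine ge_of_tendsto h2 ?_
      filter_upwards [Ioo_mem_nhdsGT (zero_lt_one' ℝ)] with δ hδ
      exact h1 δ hδ.1 hδ.2
  have hcl : IsClosed (Y : Set X) := T.isClosed_ker
  refine ⟨Y, hcl, ⟨?_⟩⟩
  refine LinearIsometryEquiv.ofSurjective ⟨Y.liftQ (T : X →ₗ[𝕜] Z) le_rfl, hnorm⟩ ?_
  intro u
  obtain ⟨x, hx, -⟩ := hsurj (1/2) (by norm_num) (by norm_num) u
  exact ⟨Submodule.Quotient.mk x, hx⟩

theorem aux_hb {𝕜 X : Type*} [RCLike 𝕜] [NormedAddCommGroup X] [NormedSpace 𝕜 X]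
    {ε : ℕ → ℝ} {x : ℕ → X} (hε : ∀ n, 0 < ε n ∧ ε n < 1)
    (hx : ∀ (m : ℕ) (a : ℕ → 𝕜),
      (∑ n ∈ Finset.range m, (1 - ε n) * ‖a n‖) ≤ ‖∑ n ∈ Finset.range m, a n • x n‖)
    (c : ℕ → 𝕜) (hc : ∀ n, ‖c n‖ ≤ 1 - ε n) :
    ∃ φ : StrongDual 𝕜 X, ‖φ‖ ≤ 1 ∧ ∀ n, φ (x n) = c n := by
  have hfs : ∀ (l : ℕ →₀ 𝕜), ∃ m, l.support ⊆ range m := fun l => by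
    obtain ⟨m, hm⟩ := Finset.exists_nat_subset_range l.support
    exact ⟨m, hm⟩
  have hlin : LinearIndependent 𝕜 x := by
    rw [linearIndependent_iff]
    intro l hl
    obtain ⟨m, hm⟩ := hfs l
    rw [Finsupp.linearCombination_apply, Finsupp.sum_of_support_subset _ hm _ (by simp)] at hl
    have h := hx m l
    rw [hl, norm_zero] at h
    have hnn : ∀ n ∈ range m, 0 ≤ (1 - ε n) * ‖l n‖ := fun n _ =>
      mul_nonneg (by linarith [(hε n).2]) (norm_nonneg _)
    have h0 := (Finset.sum_eq_zero_iff_of_nonneg hnn).1 (le_antisymm h (Finset.sum_nonneg hnn))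
    ext n
    by_cases hn : n ∈ range m
    · have := h0 n hn
      have h1 : 1 - ε n ≠ 0 := by linarith [(hε n).2]
      simpa [h1] using this
    · by_contra h
      exact hn (hm (by simpa using h))
  obtain ⟨f, hfx⟩ : ∃ f : Submodule.span 𝕜 (Set.range x) →ₗ[𝕜] 𝕜,
      ∀ n, f ⟨x n, Submodule.subset_span ⟨n, rfl⟩⟩ = c n := by
    refine ⟨(Module.Basis.span hlin).constr 𝕜 c, fun n => ?_⟩
    have h1 := (Module.Basis.span hlin).constr_basis 𝕜 c n
    have h2 : Module.Basis.span hlin n = ⟨x n, Submodule.subset_span ⟨n, rfl⟩⟩ :=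
      Module.Basis.span_apply hlin n
    rw [← h2]
    exact h1
  have hf : ∀ z, ‖f z‖ ≤ 1 * ‖z‖ := by
    intro z
    obtain ⟨l, hl⟩ := Finsupp.mem_span_range_iff_exists_finsupp.1 z.2
    obtain ⟨m, hm⟩ := hfs l
    rw [Finsupp.sum_of_support_subset _ hm _ (by simp)] at hl
    have hz : z = ∑ n ∈ range m, l n • (⟨x n, Submodule.subset_span ⟨n, rfl⟩⟩ :
        Submodule.span 𝕜 (Set.range x)) := by
      apply Subtype.ext
      rw [← hl]
      push_cast
      rfl
    have hfz : f z = ∑ n ∈ range m, l n * c n := by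
      rw [hz, map_sum]
      refine Finset.sum_congr rfl fun n _ => ?_
      rw [map_smul, hfx, smul_eq_mul]
    rw [one_mul, hfz, Submodule.coe_norm, ← hl]
    refine (norm_sum_le _ _).trans (le_trans (Finset.sum_le_sum fun n _ => ?_) (hx m l))
    rw [norm_mul, mul_comm]
    exact mul_le_mul_of_nonneg_right (hc n) (norm_nonneg _)
  obtain ⟨φ, hφ, hφn⟩ := exists_extension_norm_eq _ (f.mkContinuous 1 hf)
  refine ⟨φ, hφn.trans_le (LinearMap.mkContinuous_norm_le _ zero_le_one _), fun n => ?_⟩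
  have h1 := hφ ⟨x n, Submodule.subset_span ⟨n, rfl⟩⟩
  rw [LinearMap.mkContinuous_apply, hfx] at h1
  exact h1

theorem aux_tietze {𝕜 : Type*} [RCLike 𝕜] {h : (ℕ → Bool) → (ℕ → Bool)} (hc : Continuous h)
    (hi : Function.Injective h) (u : C((ℕ → Bool), 𝕜)) (hu : ‖u‖ ≤ 1) :
    ∃ F : C((ℕ → Bool), 𝕜), ‖F‖ ≤ 1 ∧ ∀ s, F (h s) = u s := by
  have : TietzeExtension.{0} (Metric.closedBall (0 : 𝕜) 1) :=
    Metric.instTietzeExtensionClosedBall 𝕜 0 one_pos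
  obtain ⟨F, hF, hF2⟩ := ContinuousMap.exists_extension_forall_mem
    (hc.isClosedEmbedding hi) u (t := Metric.closedBall (0 : 𝕜) 1)
    (fun s => by simpa using (u.norm_coe_le_norm s).trans hu)
  refine ⟨F, (ContinuousMap.norm_le _ zero_le_one).2 fun s => by simpa using hF s, fun s => ?_⟩
  exact DFunLike.congr_fun hF2 s

/-- If a separable Banach space `X` contains asymptotically isometric copies of `ℓ₁`,
then `C(Δ)` (continuous functions on the Cantor set `Δ = ℕ → Bool`) is isometric to a
quotient space of `X`. -/
theorem CDelta_quotient_of_separable_ai (𝕜 : Type*) [RCLike 𝕜]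
    (X : Type*) [NormedAddCommGroup X] [NormedSpace 𝕜 X] [CompleteSpace X]
    [TopologicalSpace.SeparableSpace X]
    (h : ContainsAICopiesOfL1 𝕜 X) :
    ∃ Y : Subspace 𝕜 X, IsClosed (Y : Set X) ∧
      Nonempty ((X ⧸ Y) ≃ₗᵢ[𝕜] C((ℕ → Bool), 𝕜)) := by
  obtain ⟨ε, x, hε, hε0, hx⟩ := h
  have hxn : ∀ n, ‖x n‖ ≤ 1 := by
    intro n
    have := (hx (n + 1) (Pi.single n 1)).2
    simpa [Finset.sum_range_succ, Pi.single_apply, ite_smul, apply_ite norm] using this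
  -- a dense sequence in the unit ball of `C(Δ)`
  let B : Set C((ℕ → Bool), 𝕜) := Metric.closedBall 0 1
  have hBne : Nonempty B := ⟨⟨0, by simp [B]⟩⟩
  let e : ℕ → B := TopologicalSpace.denseSeq B
  have he : DenseRange e := TopologicalSpace.denseRange_denseSeq B
  let f : ℕ → C((ℕ → Bool), 𝕜) := fun n => (e n.unpair.1).1
  have hf1 : ∀ n, ‖f n‖ ≤ 1 := fun n => mem_closedBall_zero_iff.1 (e n.unpair.1).2
  -- the compact set
  let W : Set (WeakDual 𝕜 X) := WeakDual.toStrongDual ⁻¹' Metric.closedBall (0 : StrongDual 𝕜 X) 1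
  have hWc : IsCompact W := WeakDual.isCompact_closedBall 0 1
  have hWC : CompactSpace W := isCompact_iff_compactSpace.1 hWc
  have hWm : TopologicalSpace.MetrizableSpace W := WeakDual.metrizable_of_isCompact 𝕜 X W hWc
  let K : Set ((ℕ → Bool) × W) :=
    {p | ∀ n, p.2.1 (x n) = ((1 - ε n : ℝ) : 𝕜) * f n p.1}
  have hKcl : IsClosed K := by
    have : K = ⋂ n, {p | p.2.1 (x n) = ((1 - ε n : ℝ) : 𝕜) * f n p.1} := by
      ext p
      simp [K]
    rw [this]
    refine isClosed_iInter fun n => isClosed_eq ?_ ?_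
    · exact (WeakDual.eval_continuous (x n)).comp (continuous_subtype_val.comp continuous_snd)
    · exact continuous_const.mul ((f n).continuous.comp continuous_fst)
  have hKC : CompactSpace K := isCompact_iff_compactSpace.1 hKcl.isCompact
  obtain ⟨g, hg, hgi⟩ := aux_section (K := K) (q := fun p => p.1.1)
    (continuous_fst.comp continuous_subtype_val) (by
      intro t
      obtain ⟨φ, hφ, hφx⟩ := aux_hb hε (fun m a => (hx m a).1)
        (fun n => ((1 - ε n : ℝ) : 𝕜) * f n t) (fun n => by
          have h1 : 0 ≤ 1 - ε n := by linarith [(hε n).2]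
          rw [norm_mul, RCLike.norm_ofReal, abs_of_nonneg h1]
          exact mul_le_of_le_one_right h1 (((f n).norm_coe_le_norm t).trans (hf1 n)))
      exact ⟨⟨(t, ⟨StrongDual.toWeakDual φ, by simpa [W] using hφ⟩), hφx⟩, rfl⟩)
  have hgn : ∀ s y, ‖(g s).1.2.1 y‖ ≤ ‖y‖ := by
    intro s y
    have h1 : ‖WeakDual.toStrongDual (g s).1.2.1‖ ≤ 1 :=
      mem_closedBall_zero_iff.1 (g s).1.2.2
    simpa using (WeakDual.toStrongDual (g s).1.2.1).le_of_opNorm_le h1 y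
  have hgc : ∀ y, Continuous fun s => (g s).1.2.1 y := fun y =>
    (WeakDual.eval_continuous y).comp (continuous_subtype_val.comp
      (continuous_snd.comp (continuous_subtype_val.comp hg)))
  let T₀ : X →ₗ[𝕜] C((ℕ → Bool), 𝕜) :=
    { toFun := fun y => ⟨fun s => (g s).1.2.1 y, hgc y⟩
      map_add' := fun y z => by ext s; exact map_add (g s).1.2.1 y z
      map_smul' := fun a y => by ext s; exact map_smul (g s).1.2.1 a y }
  have hT₀ : ∀ y, ‖T₀ y‖ ≤ 1 * ‖y‖ := fun y => by
    rw [one_mul]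
    exact (ContinuousMap.norm_le _ (norm_nonneg y)).2 fun s => hgn s y
  refine aux_quotient (T₀.mkContinuous 1 hT₀) (fun y => by simpa using hT₀ y) ?_
  intro u hu δ hδ
  obtain ⟨F, hF, hFu⟩ := aux_tietze ((continuous_fst.comp continuous_subtype_val).comp hg) hgi u hu
  obtain ⟨k, hk⟩ := he.exists_dist_lt ⟨F, by simpa [B] using hF⟩ (half_pos hδ)
  have hk' : ‖F - (e k).1‖ < δ / 2 := by rw [← dist_eq_norm]; exact hk
  obtain ⟨N, hN⟩ := eventually_atTop.1 (hε0.eventually (gt_mem_nhds (half_pos hδ)))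
  let n := Nat.pair k N
  have hn : ε n < δ / 2 := hN n (Nat.right_le_pair k N)
  have hfn : f n = (e k).1 := by simp [f, n]
  refine ⟨x n, hxn n, (ContinuousMap.norm_le _ hδ.le).2 fun s => ?_⟩
  have h1 : (g s).1.2.1 (x n) = ((1 - ε n : ℝ) : 𝕜) * f n (g s).1.1 := (g s).2 n
  have h2 : (u - T₀.mkContinuous 1 hT₀ (x n)) s
      = (F - (e k).1) (g s).1.1 + ((ε n : ℝ) : 𝕜) * f n (g s).1.1 := by
    have h3 : (u - T₀.mkContinuous 1 hT₀ (x n)) s = u s - (g s).1.2.1 (x n) := rfl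
    have h4 : F (g s).1.1 = u s := hFu s
    rw [h3, h1, ← h4, ContinuousMap.sub_apply, ← hfn]
    push_cast
    ring
  rw [h2]
  have h5 := (F - (e k).1).norm_coe_le_norm (g s).1.1
  have h6 : ‖((ε n : ℝ) : 𝕜) * f n (g s).1.1‖ ≤ ε n := by
    rw [norm_mul, RCLike.norm_ofReal, abs_of_pos (hε n).1]
    exact mul_le_of_le_one_right (hε n).1.le (((f n).norm_coe_le_norm _).trans (hf1 n))
  refine (norm_add_le _ _).trans ?_
  linarith
end

section
/- Let X be a real or complex Banach space and suppose C(Δ), the Banach space of continuous scalar-valued functions on the Cantor set with the supremum norm, is isometric to a quotient space of X (i.e. there exist a closed subspace Y of X and a surjective linear isometry from X/Y onto C(Δ)). Then X contains asymptotically isometric copies of ℓ₁. -/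
open Filter Finset

theorem exists_isometric_l1_CDelta (𝕜 : Type*) [RCLike 𝕜] :
    ∃ f : ℕ → C((ℕ → Bool), 𝕜), (∀ n, ‖f n‖ ≤ 1) ∧
      ∀ (m : ℕ) (a : ℕ → 𝕜), ∑ n ∈ Finset.range m, ‖a n‖ ≤
        ‖∑ n ∈ Finset.range m, a n • f n‖ := by
  have : CompactSpace (Metric.closedBall (0 : 𝕜) 1) :=
    isCompact_iff_compactSpace.1 (isCompact_closedBall _ _)
  have : Nonempty (Metric.closedBall (0 : 𝕜) 1) := ⟨⟨0, by simp⟩⟩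
  obtain ⟨g, hg, hgs⟩ :=
    exists_nat_bool_continuous_surjective_of_compact (Metric.closedBall (0 : 𝕜) 1)
  refine ⟨fun n => ⟨fun t => (g (fun k => t (Nat.pair n k)) : 𝕜), by fun_prop⟩, ?_, ?_⟩
  · intro n
    rw [ContinuousMap.norm_le _ zero_le_one]
    intro t
    exact mem_closedBall_zero_iff.1 (g (fun k => t (Nat.pair n k))).2
  · intro m a
    have key : ∀ n, ∃ s : ℕ → Bool, a n * (g s : 𝕜) = (‖a n‖ : 𝕜) := by
      intro n
      by_cases h0 : a n = 0
      · exact ⟨fun _ => true, by simp [h0]⟩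
      · have hn : ‖a n‖ ≠ 0 := norm_ne_zero_iff.2 h0
        obtain ⟨s, hs⟩ := hgs ⟨(‖a n‖ : 𝕜) / a n, by simp [hn]⟩
        exact ⟨s, by rw [hs]; field_simp⟩
    choose s hs using key
    refine le_trans ?_ (ContinuousMap.norm_coe_le_norm _
      (fun j => s (Nat.unpair j).1 (Nat.unpair j).2))
    simp only [ContinuousMap.coe_sum, Finset.sum_apply, ContinuousMap.coe_smul, Pi.smul_apply,
      ContinuousMap.coe_mk, Nat.unpair_pair, smul_eq_mul]
    simp only [hs]
    rw [← RCLike.ofReal_sum, RCLike.norm_ofReal]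
    exact le_abs_self _

/-- If `C(Δ)` (continuous functions on the Cantor set `Δ = ℕ → Bool`) is isometric to a
quotient space of `X`, then `X` contains asymptotically isometric copies of `ℓ₁`. -/
theorem ai_of_CDelta_quotient (𝕜 : Type*) [RCLike 𝕜]
    (X : Type*) [NormedAddCommGroup X] [NormedSpace 𝕜 X] [CompleteSpace X]
    (Y : Subspace 𝕜 X) (hY : IsClosed (Y : Set X))
    (h : Nonempty ((X ⧸ Y) ≃ₗᵢ[𝕜] C((ℕ → Bool), 𝕜))) :
    ContainsAICopiesOfL1 𝕜 X := by
  obtain ⟨e⟩ := h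
  obtain ⟨f, hf1, hf⟩ := exists_isometric_l1_CDelta 𝕜
  have hε : ∀ n : ℕ, (0 : ℝ) < 1 / ((n : ℝ) + 2) ∧ 1 / ((n : ℝ) + 2) < 1 := by
    intro n
    refine ⟨by positivity, ?_⟩
    rw [div_lt_one (by positivity)]
    linarith [(Nat.cast_nonneg n : (0 : ℝ) ≤ n)]
  have hx : ∀ n : ℕ, ∃ x : X, e (Submodule.Quotient.mk x) =
      ((1 - 1 / ((n : ℝ) + 2) : ℝ) : 𝕜) • f n ∧ ‖x‖ ≤ 1 := by
    intro n
    obtain ⟨x, hx, hxn⟩ := Submodule.Quotient.norm_mk_lt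
      (e.symm (((1 - 1 / ((n : ℝ) + 2) : ℝ) : 𝕜) • f n)) (hε n).1
    refine ⟨x, by rw [hx]; simp, hxn.le.trans ?_⟩
    rw [LinearIsometryEquiv.norm_map, norm_smul, RCLike.norm_ofReal,
      abs_of_nonneg (by linarith [(hε n).2])]
    nlinarith [hf1 n, (hε n).2]
  choose x hx hxn using hx
  refine ⟨fun n => 1 / ((n : ℝ) + 2), x, hε, ?_, ?_⟩
  · have := (tendsto_add_atTop_iff_nat (f := fun n : ℕ => 1 / (n : ℝ)) 2).2
      tendsto_one_div_atTop_nhds_zero_nat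
    simpa using this
  · intro m a
    constructor
    · have h1 := hf m (fun n => a n * ((1 - 1 / ((n : ℝ) + 2) : ℝ) : 𝕜))
      have h2 : e (Submodule.Quotient.mk (∑ n ∈ Finset.range m, a n • x n)) =
          ∑ n ∈ Finset.range m, (a n * ((1 - 1 / ((n : ℝ) + 2) : ℝ) : 𝕜)) • f n := by
        rw [← Submodule.mkQ_apply, map_sum, map_sum]
        refine Finset.sum_congr rfl fun n _ => ?_
        rw [map_smul, map_smul, Submodule.mkQ_apply, hx, smul_smul]
      rw [← h2, LinearIsometryEquiv.norm_map] at h1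
      refine le_trans (le_of_eq ?_) (h1.trans (Submodule.Quotient.norm_mk_le Y _))
      refine Finset.sum_congr rfl fun n _ => ?_
      rw [norm_mul, RCLike.norm_ofReal, abs_of_nonneg (by linarith [(hε n).2]), mul_comm]
    · refine (norm_sum_le _ _).trans (Finset.sum_le_sum fun n _ => ?_)
      rw [norm_smul]
      exact mul_le_of_le_one_right (norm_nonneg _) (hxn n)
end

section
/- Let ε > 0 and let (γ_n) be a sequence of nonzero scalars with (∑_n |γ_n|²)^{1/2} ≤ ε. Define a norm on ℓ₁ by ‖(a_n)‖₁′ = inf { [ ‖(a_n + b_n)‖₁² + ‖(γ_n^{-1} b_n)‖₂² ]^{1/2} : (b_n) is a scalar sequence with (γ_n^{-1} b_n) ∈ ℓ₂ }. Then (1+ε²)^{-1/2} ‖(a_n)‖₁ ≤ ‖(a_n)‖₁′ ≤ ‖(a_n)‖₁ for every (a_n) ∈ ℓ₁, and the Banach space (ℓ₁, ‖·‖₁′) does not contain asymptotically isometric copies of ℓ₁. -/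
open Filter Finset

/-- The equivalent norm `‖·‖₁′` on `ℓ₁` determined by a sequence `γ`:
`‖a‖₁′ = inf { √(‖a + b‖₁² + ‖γ⁻¹ b‖₂²) : γ⁻¹ b ∈ ℓ₂ }`. -/
noncomputable def primeNorm (𝕜 : Type*) [RCLike 𝕜] (γ : ℕ → 𝕜)
    (a : lp (fun _ : ℕ => 𝕜) 1) : ℝ :=
  sInf { r : ℝ | ∃ b : ℕ → 𝕜,
    Memℓp (fun n => a n + b n) 1 ∧ Memℓp (fun n => (γ n)⁻¹ * b n) 2 ∧
    r = Real.sqrt ((∑' n, ‖a n + b n‖) ^ 2 + ∑' n, ‖(γ n)⁻¹ * b n‖ ^ 2) }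

lemma pn_l1 {𝕜 : Type*} [RCLike 𝕜] (a : lp (fun _ : ℕ => 𝕜) 1) :
    Summable (fun n => ‖a n‖) ∧ ‖a‖ = ∑' n, ‖a n‖ := by
  constructor
  · have := (lp.memℓp a).summable (by norm_num)
    simpa using this
  · have := lp.norm_eq_tsum_rpow (p := 1) (by norm_num) a
    simpa using this

lemma pn_bdd {𝕜 : Type*} [RCLike 𝕜] (γ : ℕ → 𝕜) (a : lp (fun _ : ℕ => 𝕜) 1) :
    BddBelow { r : ℝ | ∃ b : ℕ → 𝕜,
    Memℓp (fun n => a n + b n) 1 ∧ Memℓp (fun n => (γ n)⁻¹ * b n) 2 ∧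
    r = Real.sqrt ((∑' n, ‖a n + b n‖) ^ 2 + ∑' n, ‖(γ n)⁻¹ * b n‖ ^ 2) } := by
  refine ⟨0, ?_⟩
  rintro r ⟨b, -, -, rfl⟩
  exact Real.sqrt_nonneg _

lemma pn_le {𝕜 : Type*} [RCLike 𝕜] (γ : ℕ → 𝕜) (a : lp (fun _ : ℕ => 𝕜) 1) (b : ℕ → 𝕜)
    (h1 : Memℓp (fun n => a n + b n) 1) (h2 : Memℓp (fun n => (γ n)⁻¹ * b n) 2) :
    primeNorm 𝕜 γ a ≤
      Real.sqrt ((∑' n, ‖a n + b n‖) ^ 2 + ∑' n, ‖(γ n)⁻¹ * b n‖ ^ 2) :=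
  csInf_le (pn_bdd γ a) ⟨b, h1, h2, rfl⟩

lemma pn_zero_mem {𝕜 : Type*} [RCLike 𝕜] (γ : ℕ → 𝕜) (a : lp (fun _ : ℕ => 𝕜) 1) :
    Memℓp (fun n => a n + (0 : ℕ → 𝕜) n) 1 ∧ Memℓp (fun n => (γ n)⁻¹ * (0 : ℕ → 𝕜) n) 2 := by
  constructor
  · simpa using lp.memℓp a
  · have h0 : (fun n => (γ n)⁻¹ * (0 : ℕ → 𝕜) n) = 0 := by ext n; simp
    rw [h0]
    exact zero_memℓp

lemma pn_le_norm {𝕜 : Type*} [RCLike 𝕜] (γ : ℕ → 𝕜) (a : lp (fun _ : ℕ => 𝕜) 1) :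
    primeNorm 𝕜 γ a ≤ ‖a‖ := by
  have h := pn_zero_mem γ a
  have := pn_le γ a 0 h.1 h.2
  refine this.trans_eq ?_
  rw [(pn_l1 a).2]
  simp only [Pi.zero_apply, add_zero, mul_zero, norm_zero]
  simp [Real.sqrt_sq (tsum_nonneg fun n => norm_nonneg (a n))]

lemma le_pn {𝕜 : Type*} [RCLike 𝕜] (γ : ℕ → 𝕜) (a : lp (fun _ : ℕ => 𝕜) 1) (c : ℝ)
    (h : ∀ b : ℕ → 𝕜, Memℓp (fun n => a n + b n) 1 → Memℓp (fun n => (γ n)⁻¹ * b n) 2 →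
      c ≤ Real.sqrt ((∑' n, ‖a n + b n‖) ^ 2 + ∑' n, ‖(γ n)⁻¹ * b n‖ ^ 2)) :
    c ≤ primeNorm 𝕜 γ a := by
  have h0 := pn_zero_mem γ a
  refine le_csInf ⟨_, 0, h0.1, h0.2, rfl⟩ ?_
  rintro r ⟨b, h1, h2, rfl⟩
  exact h b h1 h2

lemma pn_summable {𝕜 : Type*} [RCLike 𝕜] {f : ℕ → 𝕜} (h : Memℓp f 2) :
    Summable (fun n => ‖f n‖ ^ 2) := by
  have := h.summable (by norm_num)
  simpa using this

lemma pn_key {𝕜 : Type*} [RCLike 𝕜] (γ : lp (fun _ : ℕ => 𝕜) 2) (hγ0 : ∀ n, γ n ≠ 0)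
    (a : lp (fun _ : ℕ => 𝕜) 1) (b : ℕ → 𝕜) (K : ℕ)
    (h1 : Memℓp (fun n => a n + b n) 1) (h2 : Memℓp (fun n => (γ n)⁻¹ * b n) 2) :
    ‖a‖ ≤ ∑ i ∈ Finset.range K, ‖a i‖ + ((∑' n, ‖a n + b n‖) +
      Real.sqrt (∑' n, ‖γ (n + K)‖ ^ 2) * Real.sqrt (∑' n, ‖(γ n)⁻¹ * b n‖ ^ 2)) := by
  have hs1 : Summable (fun n => ‖a n + b n‖) := by
    have := h1.summable (by norm_num)
    simpa using this
  have hs2 := pn_summable h2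
  have hsγ := (summable_nat_add_iff K).2 (pn_summable (lp.memℓp γ))
  rw [(pn_l1 a).2, ← (pn_l1 a).1.sum_add_tsum_nat_add K]
  gcongr
  refine Real.tsum_le_of_sum_range_le (fun n => norm_nonneg _) (fun M => ?_)
  have e1 : ∀ i ∈ Finset.range M, ‖a (i + K)‖ ≤ ‖a (i + K) + b (i + K)‖
      + ‖γ (i + K)‖ * ‖(γ (i + K))⁻¹ * b (i + K)‖ := by
    intro i _
    rw [← norm_mul, mul_inv_cancel_left₀ (hγ0 _)]
    have := norm_sub_le (a (i + K) + b (i + K)) (b (i + K))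
    simpa using this
  refine (Finset.sum_le_sum e1).trans ?_
  rw [Finset.sum_add_distrib]
  refine add_le_add ?_ ?_
  · have := ((summable_nat_add_iff K).2 hs1).sum_le_tsum (Finset.range M)
      (fun i _ => norm_nonneg _)
    refine this.trans ?_
    rw [← hs1.sum_add_tsum_nat_add K]
    have : 0 ≤ ∑ i ∈ Finset.range K, ‖a i + b i‖ := Finset.sum_nonneg fun i _ => norm_nonneg _
    linarith
  · refine (Real.sum_mul_le_sqrt_mul_sqrt _ _ _).trans ?_
    refine mul_le_mul (Real.sqrt_le_sqrt ?_) (Real.sqrt_le_sqrt ?_) (Real.sqrt_nonneg _)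
      (Real.sqrt_nonneg _)
    · exact hsγ.sum_le_tsum _ (fun i _ => by positivity)
    · have := ((summable_nat_add_iff K).2 hs2).sum_le_tsum (Finset.range M)
        (fun i _ => by positivity)
      refine this.trans ?_
      rw [← hs2.sum_add_tsum_nat_add K]
      have : 0 ≤ ∑ i ∈ Finset.range K, ‖(γ i)⁻¹ * b i‖ ^ 2 :=
        Finset.sum_nonneg fun i _ => by positivity
      linarith

lemma pn_lower {𝕜 : Type*} [RCLike 𝕜] (ε : ℝ) (hε : 0 < ε) (γ : lp (fun _ : ℕ => 𝕜) 2)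
    (hγ0 : ∀ n, γ n ≠ 0) (hγε : ‖γ‖ ≤ ε) (a : lp (fun _ : ℕ => 𝕜) 1) :
    (Real.sqrt (1 + ε ^ 2))⁻¹ * ‖a‖ ≤ primeNorm 𝕜 (fun n => γ n) a := by
  refine le_pn _ _ _ fun b h1 h2 => ?_
  have hk := pn_key γ hγ0 a b 0 h1 h2
  simp only [Finset.range_zero, Finset.sum_empty, zero_add, add_zero] at hk
  have hg : Real.sqrt (∑' n, ‖γ n‖ ^ 2) ≤ ε := by
    have h := lp.norm_rpow_eq_tsum (p := 2) (by norm_num) γ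
    have h' : ‖γ‖ ^ 2 = ∑' n, ‖γ n‖ ^ 2 := by simpa using h
    rw [← h', Real.sqrt_sq (norm_nonneg _)]
    exact hγε
  set S := ∑' n, ‖a n + b n‖
  set B := ∑' n, ‖(γ n)⁻¹ * b n‖ ^ 2 with hB
  have hB0 : 0 ≤ B := tsum_nonneg fun n => by positivity
  have hs := Real.sq_sqrt hB0
  set q := Real.sqrt B
  have hq : 0 ≤ q := Real.sqrt_nonneg _
  rw [inv_mul_le_iff₀ (by positivity), ← Real.sqrt_mul (by positivity)]
  apply Real.le_sqrt_of_sq_le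
  have hk2 : ‖a‖ ≤ S + ε * q := hk.trans (by gcongr)
  have : ‖a‖ ^ 2 ≤ (S + ε * q) ^ 2 := by gcongr
  rw [← hs]
  nlinarith [sq_nonneg (ε * S - q)]

lemma pn_tail {𝕜 : Type*} [RCLike 𝕜] (γ : lp (fun _ : ℕ => 𝕜) 2)
    (hγ0 : ∀ n, γ n ≠ 0) (a : lp (fun _ : ℕ => 𝕜) 1) (K : ℕ) :
    ‖a‖ ≤ ∑ i ∈ Finset.range K, ‖a i‖ +
      (1 + Real.sqrt (∑' n, ‖γ (n + K)‖ ^ 2)) * primeNorm 𝕜 (fun n => γ n) a := by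
  set G := Real.sqrt (∑' n, ‖γ (n + K)‖ ^ 2) with hG
  have hG0 : 0 ≤ G := Real.sqrt_nonneg _
  have : (‖a‖ - ∑ i ∈ Finset.range K, ‖a i‖) / (1 + G) ≤ primeNorm 𝕜 (fun n => γ n) a := by
    refine le_pn _ _ _ fun b h1 h2 => ?_
    have hk := pn_key γ hγ0 a b K h1 h2
    have hB0 : 0 ≤ ∑' n, ‖(γ n)⁻¹ * b n‖ ^ 2 := tsum_nonneg fun n => by positivity
    have hS0 : 0 ≤ ∑' n, ‖a n + b n‖ := tsum_nonneg fun n => by positivity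
    rw [← hG] at hk
    set S := ∑' n, ‖a n + b n‖
    set B := ∑' n, ‖(γ n)⁻¹ * b n‖ ^ 2
    have i1 : S ≤ Real.sqrt (S ^ 2 + B) := Real.le_sqrt_of_sq_le (by linarith)
    have i2 : Real.sqrt B ≤ Real.sqrt (S ^ 2 + B) := Real.sqrt_le_sqrt (by nlinarith)
    rw [div_le_iff₀ (by positivity)]
    nlinarith [mul_le_mul_of_nonneg_left i2 hG0]
  rw [div_le_iff₀ (by positivity)] at this
  linarith

/-- Asymptotically: a coordinatewise null sequence in the `‖·‖₁′` unit ball is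
asymptotically in the `‖·‖₁` unit ball. -/
lemma pn_asym {𝕜 : Type*} [RCLike 𝕜] (γ : lp (fun _ : ℕ => 𝕜) 2)
    (hγ0 : ∀ n, γ n ≠ 0) (y : ℕ → lp (fun _ : ℕ => 𝕜) 1)
    (hy : ∀ᶠ n in atTop, primeNorm 𝕜 (fun n => γ n) (y n) ≤ 1)
    (hc : ∀ i, Tendsto (fun n => y n i) atTop (nhds 0)) (η : ℝ) (hη : 0 < η) :
    ∀ᶠ n in atTop, ‖y n‖ ≤ 1 + η := by
  have hG : Tendsto (fun K => Real.sqrt (∑' n, ‖γ (n + K)‖ ^ 2)) atTop (nhds 0) := by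
    have := (tendsto_sum_nat_add (fun n => ‖γ n‖ ^ 2)).sqrt
    simpa using this
  obtain ⟨K, hK⟩ := (hG.eventually (gt_mem_nhds (half_pos hη))).exists
  have hs : Tendsto (fun n => ∑ i ∈ Finset.range K, ‖y n i‖) atTop (nhds 0) := by
    have := tendsto_finsetSum (Finset.range K) (fun i _ => (hc i).norm)
    simpa using this
  filter_upwards [hy, hs.eventually (gt_mem_nhds (half_pos hη))] with n h1 h2
  have := pn_tail γ hγ0 (y n) K
  have hG0 := Real.sqrt_nonneg (∑' n, ‖γ (n + K)‖ ^ 2)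
  nlinarith [mul_le_mul_of_nonneg_left h1 (by linarith : 0 ≤ 1 + Real.sqrt (∑' n, ‖γ (n + K)‖ ^ 2))]

/-- Upper estimate of the norm of `t x + y`. -/
lemma pn_upper {𝕜 : Type*} [RCLike 𝕜] (γ : ℕ → 𝕜) (x y : lp (fun _ : ℕ => 𝕜) 1)
    (t : ℝ) (ht : 0 ≤ t) (K : ℕ) :
    primeNorm 𝕜 γ ((t : 𝕜) • x + y) ≤ Real.sqrt ((‖y‖ + t * ∑' n, ‖x (n + K)‖) ^ 2 +
      t ^ 2 * ∑ i ∈ Finset.range K, ‖(γ i)⁻¹ * x i‖ ^ 2) := by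
  set b : ℕ → 𝕜 := fun n => if n < K then -((t : 𝕜) * x n) else 0 with hb
  have hx := (pn_l1 x).1
  have hy := (pn_l1 y).1
  set u : ℕ → 𝕜 := fun n => if n < K then 0 else (t : 𝕜) * x n with hu
  have hu0 : ∀ n, ‖u n‖ ≤ t * ‖x n‖ := by
    intro n
    simp only [hu]
    split_ifs
    · simp; positivity
    · simp [abs_of_nonneg ht]
  have hus : Summable (fun n => ‖u n‖) :=
    Summable.of_nonneg_of_le (fun n => norm_nonneg _) hu0 (hx.mul_left t)
  have hab : ∀ n, ((t : 𝕜) • x + y) n + b n = u n + y n := by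
    intro n
    have : ((t : 𝕜) • x + y) n = (t : 𝕜) * x n + y n := rfl
    rw [this]
    simp only [hb, hu]
    split_ifs <;> ring
  have hut : ∑' n, ‖u n‖ = t * ∑' n, ‖x (n + K)‖ := by
    rw [← hus.sum_add_tsum_nat_add K, ← tsum_mul_left]
    rw [Finset.sum_eq_zero, zero_add]
    · refine tsum_congr fun n => ?_
      simp [hu, abs_of_nonneg ht]
    · intro i hi
      simp [hu, Finset.mem_range.1 hi]
  have huy : Summable (fun n => ‖u n + y n‖) :=
    Summable.of_nonneg_of_le (fun n => norm_nonneg _) (fun n => norm_add_le _ _) (hus.add hy)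
  have hbz : ∀ n ∉ Finset.range K, ‖(γ n)⁻¹ * b n‖ ^ 2 = 0 := by
    intro n hn
    simp [hb, Finset.mem_range.not.1 hn]
  have h1 : Memℓp (fun n => ((t : 𝕜) • x + y) n + b n) 1 := by
    simp only [hab]
    apply memℓp_gen
    simpa using huy
  have h2 : Memℓp (fun n => (γ n)⁻¹ * b n) 2 := by
    apply memℓp_gen
    have : Summable (fun n => ‖(γ n)⁻¹ * b n‖ ^ 2) := summable_of_ne_finset_zero hbz
    simpa using this
  refine (pn_le γ _ b h1 h2).trans (Real.sqrt_le_sqrt ?_)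
  simp only [hab]
  rw [tsum_eq_sum hbz, Finset.mul_sum]
  refine add_le_add ?_ (Finset.sum_le_sum fun i hi => ?_)
  · have : 0 ≤ ∑' n, ‖u n + y n‖ := tsum_nonneg fun n => norm_nonneg _
    refine pow_le_pow_left₀ this ?_ 2
    rw [← hut, (pn_l1 y).2, add_comm, ← hus.tsum_add hy]
    exact huy.tsum_le_tsum (fun n => norm_add_le _ _) (hus.add hy)
  · simp only [hb, Finset.mem_range.1 hi, if_true]
    rw [norm_mul, norm_neg, norm_mul, norm_mul, RCLike.norm_ofReal, abs_of_nonneg ht]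
    apply le_of_eq
    ring

/-- The estimates of an asymptotically isometric copy applied to `t x₀ + (xᵢ - xⱼ)/2`. -/
lemma pn_three {𝕜 : Type*} [RCLike 𝕜] (N : lp (fun _ : ℕ => 𝕜) 1 → ℝ) (δ : ℕ → ℝ)
    (x : ℕ → lp (fun _ : ℕ => 𝕜) 1)
    (h : ∀ (m : ℕ) (a : ℕ → 𝕜),
      (∑ n ∈ Finset.range m, (1 - δ n) * ‖a n‖) ≤ N (∑ n ∈ Finset.range m, a n • x n) ∧
      N (∑ n ∈ Finset.range m, a n • x n) ≤ ∑ n ∈ Finset.range m, ‖a n‖)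
    (t : ℝ) (ht : 0 ≤ t) (i j : ℕ) (hi : 0 < i) (hij : i < j) :
    (1 - δ 0) * t + ((1 - δ i) / 2 + (1 - δ j) / 2) ≤
      N ((t : 𝕜) • x 0 + (2⁻¹ : 𝕜) • (x i - x j)) ∧
    N ((t : 𝕜) • x 0 + (2⁻¹ : 𝕜) • (x i - x j)) ≤ t + 1 := by
  set a : ℕ → 𝕜 := fun n => (if n = 0 then (t : 𝕜) else 0) + ((if n = i then (2⁻¹ : 𝕜) else 0) +
    (if n = j then (-2⁻¹ : 𝕜) else 0)) with ha
  have hn : ∀ n, ‖a n‖ = (if n = 0 then t else 0) + ((if n = i then (2⁻¹ : ℝ) else 0) +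
    (if n = j then (2⁻¹ : ℝ) else 0)) := by
    intro n
    simp only [ha]
    rcases eq_or_ne n 0 with h0 | h0
    · have e1 : n ≠ i := by omega
      have e2 : n ≠ j := by omega
      simp [h0, e1, e2, hi.ne, (hi.trans hij).ne, abs_of_nonneg ht]
    · rcases eq_or_ne n i with h1 | h1
      · have e2 : i ≠ j := by omega
        simp [h1, e2, hi.ne']
      · rcases eq_or_ne n j with h2 | h2
        · have e2 : j ≠ i := by omega
          simp [h2, e2, (hi.trans hij).ne']
        · simp [h0, h1, h2]
  have hi' : i < j + 1 := by omega
  have hsum : ∑ n ∈ Finset.range (j + 1), a n • x n =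
      (t : 𝕜) • x 0 + (2⁻¹ : 𝕜) • (x i - x j) := by
    simp only [ha, add_smul, ite_smul, zero_smul, Finset.sum_add_distrib, Finset.sum_ite_eq',
      Finset.mem_range, hi', Nat.succ_pos, Nat.lt_succ_self, if_true]
    simp [smul_sub, sub_eq_add_neg]
  have := h (j + 1) a
  rw [hsum] at this
  simp only [hn, mul_add, mul_ite, mul_zero, Finset.sum_add_distrib, Finset.sum_ite_eq',
      Finset.mem_range, hi', Nat.succ_pos, Nat.lt_succ_self, if_true] at this
  constructor
  · refine le_trans (le_of_eq ?_) this.1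
    ring
  · refine this.2.trans (le_of_eq ?_)
    ring

lemma pn_no_copy {𝕜 : Type*} [RCLike 𝕜] (ε : ℝ) (hε : 0 < ε) (γ : lp (fun _ : ℕ => 𝕜) 2)
    (hγ0 : ∀ n, γ n ≠ 0) (hγε : ‖γ‖ ≤ ε) (δ : ℕ → ℝ) (x : ℕ → lp (fun _ : ℕ => 𝕜) 1)
    (hδ : ∀ n, 0 < δ n ∧ δ n < 1) (hδ0 : Tendsto δ atTop (nhds 0))
    (h : ∀ (m : ℕ) (a : ℕ → 𝕜),
          (∑ n ∈ Finset.range m, (1 - δ n) * ‖a n‖) ≤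
              primeNorm 𝕜 (fun n => γ n) (∑ n ∈ Finset.range m, a n • x n) ∧
          primeNorm 𝕜 (fun n => γ n) (∑ n ∈ Finset.range m, a n • x n) ≤
              ∑ n ∈ Finset.range m, ‖a n‖) : False := by
  have hN1 : ∀ n, primeNorm 𝕜 (fun n => γ n) (x n) ≤ 1 := by
    intro n
    have := (h (n + 1) (fun k => if k = n then 1 else 0)).2
    simpa [ite_smul, apply_ite norm] using this
  have hbd : ∀ n i, x n i ∈ Metric.closedBall (0 : 𝕜) (Real.sqrt (1 + ε ^ 2)) := by
    intro n i
    rw [mem_closedBall_zero_iff]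
    refine (lp.norm_apply_le_norm (by norm_num) (x n) i).trans ?_
    have := (pn_lower ε hε γ hγ0 hγε (x n)).trans (hN1 n)
    rw [inv_mul_le_iff₀ (by positivity)] at this
    linarith
  have hcpt : IsCompact (Set.pi Set.univ
      fun _ : ℕ => Metric.closedBall (0 : 𝕜) (Real.sqrt (1 + ε ^ 2))) :=
    isCompact_univ_pi fun _ => isCompact_closedBall _ _
  obtain ⟨z, -, φ, hφ, hz⟩ := hcpt.tendsto_subseq (x := fun n i => x n i)
    (fun n i _ => hbd n i)
  have hz' : ∀ i, Tendsto (fun n => x (φ n) i) atTop (nhds (z i)) := fun i =>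
    (tendsto_pi_nhds.1 hz) i
  set y : ℕ → lp (fun _ : ℕ => 𝕜) 1 := fun n => (2⁻¹ : 𝕜) • (x (φ n) - x (φ (n + 1))) with hy
  have hyc : ∀ i, Tendsto (fun n => y n i) atTop (nhds 0) := by
    intro i
    have := ((hz' i).sub ((hz' i).comp (tendsto_add_atTop_nat 1))).const_mul (2⁻¹ : 𝕜)
    rw [sub_self, mul_zero] at this
    exact this
  have hφpos : ∀ᶠ n in atTop, 0 < φ n :=
    (hφ.tendsto_atTop).eventually (eventually_gt_atTop 0)
  have hyN : ∀ᶠ n in atTop, primeNorm 𝕜 (fun n => γ n) (y n) ≤ 1 := by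
    filter_upwards [hφpos] with n hn
    have := (pn_three _ δ x h 0 le_rfl (φ n) (φ (n + 1)) hn (hφ (Nat.lt_succ_self n))).2
    simpa using this
  set c := 1 - δ 0 with hc
  have hc0 : 0 < c := by linarith [(hδ 0).2]
  obtain ⟨K, hK⟩ := ((tendsto_sum_nat_add (fun n => ‖x 0 n‖)).eventually
    (gt_mem_nhds (half_pos hc0))).exists
  set τ := ∑' n, ‖x 0 (n + K)‖ with hτ
  set B := ∑ i ∈ Finset.range K, ‖(γ i)⁻¹ * x 0 i‖ ^ 2 with hB
  have hB0 : 0 ≤ B := Finset.sum_nonneg fun i _ => by positivity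
  have hτ0 : 0 ≤ τ := tsum_nonneg fun n => norm_nonneg _
  have hd : Tendsto (fun n => (1 - δ (φ n)) / 2 + (1 - δ (φ (n + 1))) / 2) atTop (nhds 1) := by
    have h1 := hδ0.comp hφ.tendsto_atTop
    have h2 := h1.comp (tendsto_add_atTop_nat 1)
    have := ((h1.const_sub 1).div_const 2).add ((h2.const_sub 1).div_const 2)
    norm_num at this
    exact this
  have main : ∀ t : ℝ, 0 < t → (1 + c * t) ^ 2 ≤ (1 + t * τ) ^ 2 + t ^ 2 * B := by
    intro t ht
    have key : ∀ η > 0, c * t + (1 - η) ≤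
        Real.sqrt ((1 + η + t * τ) ^ 2 + t ^ 2 * B) := by
      intro η hη
      obtain ⟨n, h1, h2, h3⟩ := ((pn_asym γ hγ0 y hyN hyc η hη).and (hφpos.and
        (hd.eventually (lt_mem_nhds (by linarith : 1 - η < 1))))).exists
      have i1 := (pn_three _ δ x h t ht.le (φ n) (φ (n + 1)) h2 (hφ (Nat.lt_succ_self n))).1
      have i2 := pn_upper (fun n => γ n) (x 0) (y n) t ht.le K
      have i3 : Real.sqrt ((‖y n‖ + t * τ) ^ 2 + t ^ 2 * B) ≤
          Real.sqrt ((1 + η + t * τ) ^ 2 + t ^ 2 * B) := by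
        apply Real.sqrt_le_sqrt
        gcongr
      linarith [i1.trans (i2.trans i3)]
    have lim : c * t + (1 - 0) ≤ Real.sqrt ((1 + 0 + t * τ) ^ 2 + t ^ 2 * B) := by
      have hl : Continuous (fun η : ℝ => c * t + (1 - η)) := by fun_prop
      have hr : Continuous (fun η : ℝ => Real.sqrt ((1 + η + t * τ) ^ 2 + t ^ 2 * B)) := by
        fun_prop
      refine le_of_tendsto_of_tendsto
        ((hl.tendsto 0).mono_left (nhdsWithin_le_nhds (s := Set.Ioi 0)))
        ((hr.tendsto 0).mono_left (nhdsWithin_le_nhds (s := Set.Ioi 0))) ?_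
      filter_upwards [self_mem_nhdsWithin] with η hη
      exact key η hη
    have := (Real.le_sqrt (by positivity) (by positivity)).1 lim
    simp only [sub_zero, add_zero] at this
    linarith
  have hD : 0 ≤ τ ^ 2 + B := by positivity
  set t := c / (2 * (τ ^ 2 + B + 1)) with ht
  have ht0 : 0 < t := by positivity
  have htD : t * (2 * (τ ^ 2 + B + 1)) = c := by
    rw [ht]; field_simp
  have m := main t ht0
  have m2 : t * (2 * c) ≤ t * (2 * τ + t * (τ ^ 2 + B)) := by nlinarith [sq_nonneg (c * t)]
  have m3 := le_of_mul_le_mul_left m2 ht0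
  nlinarith

/-- For `γ ∈ ℓ₂` with nonzero entries and `‖γ‖₂ ≤ ε`, the norm `‖·‖₁′` on `ℓ₁`
satisfies `(1+ε²)^{-1/2} ‖a‖₁ ≤ ‖a‖₁′ ≤ ‖a‖₁`, and the Banach space `(ℓ₁, ‖·‖₁′)`
does not contain asymptotically isometric copies of `ℓ₁`. -/
theorem renormed_l1_no_ai_copies (𝕜 : Type*) [RCLike 𝕜]
    (ε : ℝ) (hε : 0 < ε) (γ : lp (fun _ : ℕ => 𝕜) 2)
    (hγ0 : ∀ n, γ n ≠ 0) (hγε : ‖γ‖ ≤ ε) :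
    (∀ a : lp (fun _ : ℕ => 𝕜) 1,
      (Real.sqrt (1 + ε ^ 2))⁻¹ * ‖a‖ ≤ primeNorm 𝕜 (fun n => γ n) a ∧
      primeNorm 𝕜 (fun n => γ n) a ≤ ‖a‖) ∧
    ¬ ∃ (δ : ℕ → ℝ) (x : ℕ → lp (fun _ : ℕ => 𝕜) 1),
        (∀ n, 0 < δ n ∧ δ n < 1) ∧ Tendsto δ atTop (nhds 0) ∧
        ∀ (m : ℕ) (a : ℕ → 𝕜),
          (∑ n ∈ Finset.range m, (1 - δ n) * ‖a n‖) ≤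
              primeNorm 𝕜 (fun n => γ n) (∑ n ∈ Finset.range m, a n • x n) ∧
          primeNorm 𝕜 (fun n => γ n) (∑ n ∈ Finset.range m, a n • x n) ≤
              ∑ n ∈ Finset.range m, ‖a n‖ := by
  refine ⟨fun a => ⟨pn_lower ε hε γ hγ0 hγε a, pn_le_norm _ a⟩, ?_⟩
  rintro ⟨δ, x, hδ, hδ0, h⟩
  exact pn_no_copy ε hε γ hγ0 hγε δ x hδ hδ0 h
end
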